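/- Let n ≥ 2, let Ω be an open domain in ℂ^{n+1}, and let f : Ω → ℙ^m be a map into complex projective m-space. If for every coordinate n-plane Πⁿ in ℂ^{n+1} the restriction of f to Ω ∩ Πⁿ is holomorphic, then f is holomorphic on Ω. -/

import Mathlib

/-- A coordinate `k`-plane in `ℂⁿ`: the affine subspace obtained by fixing `n - k`
of the coordinates at constant values. -/
def IsCoordPlane (n k : ℕ) (P : Set (Fin n → ℂ)) : Prop :=
  ∃ (I : Finset (Fin n)) (c : Fin n → ℂ), I.card = n - k ∧
    P = {z | ∀ i ∈ I, z i = c i}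

/-- A map `f` from a subset `S` of a complex normed space to the complex projective
space `ℙ^m` is holomorphic on `S` if every point of `S` has an open neighbourhood `U`
and a holomorphic map `F : U → ℂ^{m+1} \ {0}` such that `f z = [F z]` for all
`z ∈ U ∩ S`. -/
def IsHolomorphicOnP {E : Type} [NormedAddCommGroup E] [NormedSpace ℂ E] {m : ℕ}
    (S : Set E) (f : E → Projectivization ℂ (Fin (m + 1) → ℂ)) : Prop :=
  ∀ z ∈ S, ∃ U : Set E, IsOpen U ∧ z ∈ U ∧
    ∃ (F : E → (Fin (m + 1) → ℂ)) (hF : ∀ w ∈ U, F w ≠ 0),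
      DifferentiableOn ℂ F U ∧
      ∀ w (hw : w ∈ U), w ∈ S → f w = Projectivization.mk ℂ (F w) (hF w hw)

open Metric Set Filter Topology MeasureTheory

/-- Second order Taylor estimate for a bounded holomorphic function on a disc. -/
theorem norm_sub_sub_deriv_le_of_bounded {F : Type*} [NormedAddCommGroup F] [NormedSpace ℂ F]
    {g : ℂ → F} {c z : ℂ} {R M : ℝ} (hg : DifferentiableOn ℂ g (ball c R))
    (hM : ∀ w ∈ ball c R, ‖g w‖ ≤ M) (hz : z ∈ ball c R) :
    ‖g z - g c - (z - c) • deriv g c‖ ≤ 4 * M * (‖z - c‖ / R) ^ 2 := by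
  have hR : 0 < R := pos_of_mem_ball hz
  have hc : c ∈ ball c R := mem_ball_self hR
  have hd : ‖deriv g c‖ ≤ 2 * M / R := by
    refine Complex.norm_deriv_le_div_of_mapsTo_ball hg (fun w hw => ?_) hR
    rw [mem_closedBall, dist_eq_norm]
    calc ‖g w - g c‖ ≤ ‖g w‖ + ‖g c‖ := norm_sub_le _ _
      _ ≤ 2 * M := by linarith [hM w hw, hM c hc]
  have hgc : HasDerivAt g (deriv g c) c :=
    (hg.differentiableAt (isOpen_ball.mem_nhds hc)).hasDerivAt
  have key := Complex.dist_le_mul_div_pow_of_mapsTo_ball_of_isLittleO (n := 1) (R₂ := 4 * M)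
    (f := fun w => g w - (w - c) • deriv g c) (c := c) (z := z) (R₁ := R) ?_ ?_ ?_ hz
  · simpa [dist_eq_norm, sub_right_comm] using key
  · exact hg.sub (by fun_prop)
  · intro w hw
    have hw' : ‖w - c‖ < R := by simpa [dist_eq_norm] using hw
    rw [mem_closedBall, dist_eq_norm]
    have h1 : ‖(w - c) • deriv g c‖ ≤ 2 * M := by
      rw [norm_smul]
      calc ‖w - c‖ * ‖deriv g c‖ ≤ R * (2 * M / R) := by gcongr
        _ = 2 * M := by field_simp
    calc ‖g w - (w - c) • deriv g c - (g c - (c - c) • deriv g c)‖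
        = ‖g w - (w - c) • deriv g c - g c‖ := by simp
      _ ≤ ‖g w‖ + ‖(w - c) • deriv g c‖ + ‖g c‖ :=
        (norm_sub_le _ _).trans (add_le_add_left (norm_sub_le _ _) _)
      _ ≤ 4 * M := by linarith [hM w hw, hM c hc]
  · have := hgc.isLittleO
    simp only [pow_one]
    have h2 := this.norm_right
    simpa [sub_right_comm] using h2

/-- The derivative in the second variable of a bounded function on a product with a disc,
holomorphic in each variable, is holomorphic in the first variable. -/
theorem differentiableOn_deriv_snd {F : Type*} [NormedAddCommGroup F] [NormedSpace ℂ F]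
    [CompleteSpace F] {G : ℂ → ℂ → F} {U : Set ℂ} {c y : ℂ} {R M : ℝ} (hU : IsOpen U)
    (h₂ : ∀ x ∈ U, DifferentiableOn ℂ (G x) (ball c R))
    (h₁ : ∀ y ∈ ball c R, DifferentiableOn ℂ (fun x => G x y) U)
    (hM : ∀ x ∈ U, ∀ y ∈ ball c R, ‖G x y‖ ≤ M) (hy : y ∈ ball c R) :
    DifferentiableOn ℂ (fun x => deriv (G x) y) U := by
  have hR' : 0 < R - dist y c := by rw [mem_ball] at hy; linarith
  have hsub : ball y (R - dist y c) ⊆ ball c R := ball_subset_ball' (by linarith)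
  have hball : ∀ᶠ h in 𝓝[≠] (0 : ℂ), y + h ∈ ball y (R - dist y c) := by
    have : ∀ᶠ h in 𝓝 (0 : ℂ), y + h ∈ ball y (R - dist y c) := by
      have hc : ContinuousAt (fun h : ℂ => y + h) 0 := by fun_prop
      exact hc.eventually_mem (isOpen_ball.mem_nhds (by simpa using hR'))
    exact this.filter_mono nhdsWithin_le_nhds
  have hunif : TendstoUniformlyOn (fun (h : ℂ) x => h⁻¹ • (G x (y + h) - G x y))
      (fun x => deriv (G x) y) (𝓝[≠] (0 : ℂ)) U := by
    rw [Metric.tendstoUniformlyOn_iff]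
    intro ε hε
    have hlim : ∀ᶠ h in 𝓝[≠] (0 : ℂ), 4 * M / (R - dist y c) ^ 2 * ‖h‖ < ε := by
      have hc : ContinuousAt (fun h : ℂ => 4 * M / (R - dist y c) ^ 2 * ‖h‖) 0 := by fun_prop
      exact (hc.eventually_lt continuousAt_const (by simpa using hε)).filter_mono
        nhdsWithin_le_nhds
    filter_upwards [hball, hlim, self_mem_nhdsWithin] with h hh hlt h0 x hx
    have h0' : h ≠ 0 := h0
    have key := norm_sub_sub_deriv_le_of_bounded ((h₂ x hx).mono hsub)
      (fun w hw => hM x hx w (hsub hw)) hh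
    rw [add_sub_cancel_left] at key
    rw [dist_comm, dist_eq_norm]
    have e : h⁻¹ • (G x (y + h) - G x y) - deriv (G x) y
        = h⁻¹ • (G x (y + h) - G x y - h • deriv (G x) y) := by
      rw [smul_sub h⁻¹ (G x (y + h) - G x y), inv_smul_smul₀ h0']
    rw [e, norm_smul, norm_inv]
    refine lt_of_le_of_lt ?_ hlt
    have hn : 0 < ‖h‖ := norm_pos_iff.mpr h0'
    calc ‖h‖⁻¹ * _ ≤ ‖h‖⁻¹ * (4 * M * (‖h‖ / (R - dist y c)) ^ 2) := by gcongr
      _ = 4 * M / (R - dist y c) ^ 2 * ‖h‖ := by field_simp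
  refine hunif.tendstoLocallyUniformlyOn.differentiableOn ?_ hU
  filter_upwards [hball] with h hh
  exact ((h₁ _ (hsub hh)).sub (h₁ _ hy)).const_smul _

/-- Taylor coefficients in the second variable of a bounded function, holomorphic in each
variable, are holomorphic in the first variable. -/
theorem differentiableOn_iteratedDeriv_snd {F : Type*} [NormedAddCommGroup F] [NormedSpace ℂ F]
    [CompleteSpace F] {U : Set ℂ} {c : ℂ} (hU : IsOpen U) (l : ℕ) :
    ∀ {G : ℂ → ℂ → F} {R M : ℝ}, 0 < R → (∀ x ∈ U, DifferentiableOn ℂ (G x) (ball c R)) →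
      (∀ y ∈ ball c R, DifferentiableOn ℂ (fun x => G x y) U) →
      (∀ x ∈ U, ∀ y ∈ ball c R, ‖G x y‖ ≤ M) →
      DifferentiableOn ℂ (fun x => iteratedDeriv l (G x) c) U := by
  induction l with
  | zero =>
    intro G R M hR _ h₁ _
    simpa using h₁ c (mem_ball_self hR)
  | succ l ih =>
    intro G R M hR h₂ h₁ hM
    have hsub : ball c (R / 2) ⊆ ball c R := ball_subset_ball (by linarith)
    simp only [iteratedDeriv_succ']
    refine ih (G := fun x => deriv (G x)) (R := R / 2) (M := 2 * M / (R / 2)) (by positivity)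
      (fun x hx => ((h₂ x hx).deriv isOpen_ball).mono hsub)
      (fun y hy => differentiableOn_deriv_snd hU h₂ h₁ hM (hsub hy)) (fun x hx y hy => ?_)
    have hs : ball y (R / 2) ⊆ ball c R := ball_subset_ball' (by rw [mem_ball] at hy; linarith)
    refine Complex.norm_deriv_le_div_of_mapsTo_ball ((h₂ x hx).mono hs) (fun w hw => ?_)
      (by positivity)
    rw [mem_closedBall, dist_eq_norm]
    calc ‖G x w - G x y‖ ≤ ‖G x w‖ + ‖G x y‖ := norm_sub_le _ _
      _ ≤ 2 * M := by linarith [hM x hx w (hs hw), hM x hx y (hsub hy)]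

/-- A function of several variables that is bounded, holomorphic along the lines in direction
`i`, and holomorphic on the hyperplanes on which the coordinate `i` is constant, is holomorphic. -/
theorem differentiableAt_of_update {ι F : Type*} [Fintype ι] [DecidableEq ι]
    [NormedAddCommGroup F] [NormedSpace ℂ F]
    {φ : (ι → ℂ) → F} {z₀ : ι → ℂ} {R M : ℝ} {i : ι} (hR : 0 < R)
    (hM : ∀ z ∈ ball z₀ R, ‖φ z‖ ≤ M)
    (hslice : ∀ a ∈ ball (z₀ i) R,
      DifferentiableOn ℂ (fun z => φ (Function.update z i a)) (ball z₀ R))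
    (hline : ∀ z ∈ ball z₀ R,
      DifferentiableOn ℂ (fun a => φ (Function.update z i a)) (ball (z₀ i) R)) :
    DifferentiableAt ℂ φ z₀ := by
  set c := z₀ i with hc
  have hmem : ∀ z ∈ ball z₀ R, ∀ a ∈ ball c R, Function.update z i a ∈ ball z₀ R := by
    intro z hz a ha
    rw [mem_ball, dist_pi_lt_iff hR] at hz ⊢
    intro j
    rcases eq_or_ne j i with rfl | hj
    · simpa using ha
    · simpa [hj] using hz j
  have hz₀ : z₀ ∈ ball z₀ R := mem_ball_self hR
  have hcR : c ∈ ball c R := mem_ball_self hR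
  have hM0 : 0 ≤ M := (norm_nonneg _).trans (hM z₀ hz₀)
  set D : (ι → ℂ) → F := fun z => deriv (fun a => φ (Function.update z i a)) c with hD
  have hquad : ∀ z ∈ ball z₀ R, ∀ a ∈ ball c R,
      ‖φ (Function.update z i a) - φ (Function.update z i c) - (a - c) • D z‖
        ≤ 4 * M * (‖a - c‖ / R) ^ 2 := fun z hz a ha =>
    norm_sub_sub_deriv_le_of_bounded (hline z hz) (fun w hw => hM _ (hmem z hz w hw)) ha
  have hDc : ContinuousAt D z₀ := by
    rw [Metric.continuousAt_iff']
    intro ε hε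
    obtain ⟨h, hh0, hhR, hhε⟩ : ∃ h : ℝ, 0 < h ∧ h < R ∧ 8 * M / R ^ 2 * h < ε / 2 := by
      have hcont : ContinuousAt (fun h : ℝ => 8 * M / R ^ 2 * h) 0 := by fun_prop
      have h1 : ∀ᶠ h in 𝓝[>] (0 : ℝ), 8 * M / R ^ 2 * h < ε / 2 :=
        (hcont.eventually_lt continuousAt_const (by simpa using hε)).filter_mono
          nhdsWithin_le_nhds
      have h2 : ∀ᶠ h in 𝓝[>] (0 : ℝ), h ∈ Ioo 0 R := Ioo_mem_nhdsGT hR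
      obtain ⟨h, ha, hb⟩ := (h1.and h2).exists
      exact ⟨h, hb.1, hb.2, ha⟩
    set a : ℂ := c + h with ha
    have hac : ‖a - c‖ = h := by simp [ha, abs_of_pos hh0]
    have haR : a ∈ ball c R := by rw [mem_ball, dist_eq_norm, hac]; exact hhR
    set Q : (ι → ℂ) → F := fun z => φ (Function.update z i a) - φ (Function.update z i c) with hQ
    have hQc : ContinuousAt Q z₀ :=
      (((hslice a haR).sub (hslice c hcR)).differentiableAt
        (isOpen_ball.mem_nhds hz₀)).continuousAt
    have hev := (Metric.continuousAt_iff'.1 hQc) (h * (ε / 2)) (by positivity)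
    filter_upwards [hev, isOpen_ball.mem_nhds hz₀] with z hz hzR
    have q1 := hquad z hzR a haR
    have q2 := hquad z₀ hz₀ a haR
    rw [hac] at q1 q2
    rw [dist_eq_norm] at hz ⊢
    have hk : h * ‖D z - D z₀‖ < h * ε := by
      calc h * ‖D z - D z₀‖ = ‖(a - c) • (D z - D z₀)‖ := by rw [norm_smul, hac]
        _ = ‖(Q z - Q z₀) - (Q z - (a - c) • D z) + (Q z₀ - (a - c) • D z₀)‖ := by
          congr 1; rw [smul_sub]; abel
        _ ≤ ‖Q z - Q z₀‖ + ‖Q z - (a - c) • D z‖ + ‖Q z₀ - (a - c) • D z₀‖ :=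
          (norm_add_le _ _).trans (add_le_add_left (norm_sub_le _ _) _)
        _ < h * (ε / 2) + 4 * M * (h / R) ^ 2 + 4 * M * (h / R) ^ 2 :=
          add_lt_add_of_lt_of_le (add_lt_add_of_lt_of_le hz q1) q2
        _ = h * (ε / 2) + h * (8 * M / R ^ 2 * h) := by field_simp; ring
        _ ≤ h * (ε / 2) + h * (ε / 2) := by gcongr
        _ = h * ε := by ring
    exact lt_of_mul_lt_mul_left hk hh0.le
  obtain ⟨L₁, hL₁⟩ := (hslice c hcR).differentiableAt (isOpen_ball.mem_nhds hz₀)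
  refine ⟨L₁ + (ContinuousLinearMap.proj (R := ℂ) (φ := fun _ : ι => ℂ) i).smulRight (D z₀), ?_⟩
  rw [hasFDerivAt_iff_isLittleO] at hL₁ ⊢
  have hcoord : ∀ z : ι → ℂ, ‖z i - c‖ ≤ ‖z - z₀‖ := fun z => norm_le_pi_norm (z - z₀) i
  have hupd : Function.update z₀ i c = z₀ := by rw [hc, Function.update_eq_self]
  have o1 : (fun z => φ z - φ (Function.update z i c) - (z i - c) • D z)
      =o[𝓝 z₀] fun z => z - z₀ := by
    rw [Asymptotics.isLittleO_iff]
    intro ε hε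
    have hcont : ContinuousAt (fun z : ι → ℂ => 4 * M / R ^ 2 * ‖z - z₀‖) z₀ := by fun_prop
    filter_upwards [isOpen_ball.mem_nhds hz₀,
      hcont.eventually_lt continuousAt_const (by simpa using hε)] with z hz hlt
    have hzi : z i ∈ ball c R := by
      rw [mem_ball, dist_eq_norm] at hz ⊢
      exact (hcoord z).trans_lt hz
    have := hquad z hz (z i) hzi
    rw [Function.update_eq_self] at this
    refine this.trans ?_
    calc 4 * M * (‖z i - c‖ / R) ^ 2 ≤ 4 * M * (‖z - z₀‖ / R) ^ 2 := by
          gcongr; exact hcoord z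
      _ = 4 * M / R ^ 2 * ‖z - z₀‖ * ‖z - z₀‖ := by field_simp
      _ ≤ ε * ‖z - z₀‖ := by gcongr
  have o2 : (fun z => (z i - c) • (D z - D z₀)) =o[𝓝 z₀] fun z => z - z₀ := by
    rw [Asymptotics.isLittleO_iff]
    intro ε hε
    filter_upwards [(Metric.continuousAt_iff'.1 hDc) ε hε] with z hz
    rw [dist_eq_norm] at hz
    rw [norm_smul, mul_comm ε]
    gcongr
    exact hcoord z
  refine ((o1.add o2).add hL₁).congr_left fun z => ?_
  simp only [hupd, add_apply, ContinuousLinearMap.smulRight_apply,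
    ContinuousLinearMap.proj_apply, Pi.sub_apply, smul_sub]
  rw [← hc]
  abel

/-- A set of small area in the plane meets some circle of radius between `s / 2` and `s` in a set
of small angular measure. -/
theorem exists_radius_volume_angle_le {T : Set ℂ} (hT : MeasurableSet T) {ζ : ℂ} {s ε : ℝ}
    (hs : 0 < s) (hTv : volume T < ENNReal.ofReal (ε * s ^ 2 / 4)) :
    ∃ ρ ∈ Ioo (s / 2) s,
      volume ({θ : ℝ | circleMap ζ ρ θ ∈ T} ∩ Ioo (-Real.pi) Real.pi) ≤ ENNReal.ofReal ε := by
  by_contra! hcon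
  have hmeas : Measurable fun q : ℝ × ℝ => circleMap ζ q.1 q.2 := by
    unfold circleMap; fun_prop
  refine hTv.not_ge ?_
  have hvol : volume T = ∫⁻ z : ℂ, T.indicator 1 (ζ + z) := by
    rw [lintegral_add_left_eq_self (fun z => T.indicator 1 z) ζ, lintegral_indicator_one hT]
  have hcirc : ∀ q : ℝ × ℝ, ζ + Complex.polarCoord.symm q = circleMap ζ q.1 q.2 := fun q => by
    rw [Complex.polarCoord_symm_apply, circleMap, Complex.exp_mul_I, Complex.ofReal_cos,
      Complex.ofReal_sin]
  rw [hvol, ← Complex.lintegral_comp_polarCoord_symm, polarCoord_target, Measure.volume_eq_prod,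
    ← Measure.prod_restrict, lintegral_prod]
  · calc ENNReal.ofReal (ε * s ^ 2 / 4)
        = ∫⁻ _ in Ioo (s / 2) s, ENNReal.ofReal (s / 2) * ENNReal.ofReal ε := by
          rw [setLIntegral_const, Real.volume_Ioo, ← ENNReal.ofReal_mul (by positivity),
            ← ENNReal.ofReal_mul' (by linarith)]
          congr 1; ring
      _ ≤ ∫⁻ ρ in Ioo (s / 2) s, ∫⁻ θ in Ioo (-Real.pi) Real.pi,
          ENNReal.ofReal ρ • T.indicator 1 (ζ + Complex.polarCoord.symm (ρ, θ)) := by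
          refine setLIntegral_mono' measurableSet_Ioo fun ρ hρ => ?_
          have hm : MeasurableSet {θ : ℝ | circleMap ζ ρ θ ∈ T} :=
            (measurable_circleMap ζ ρ) hT
          have e : ∀ θ : ℝ, T.indicator (1 : ℂ → ENNReal) (ζ + Complex.polarCoord.symm (ρ, θ))
              = {θ : ℝ | circleMap ζ ρ θ ∈ T}.indicator 1 θ := fun θ => by
            rw [hcirc]; rfl
          simp only [e, smul_eq_mul]
          rw [lintegral_const_mul _ (measurable_one.indicator hm), lintegral_indicator_one hm,
            Measure.restrict_apply hm]
          gcongr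
          · exact hρ.1.le
          · exact (hcon ρ hρ).le
      _ ≤ _ := lintegral_mono_set fun ρ hρ => (by linarith [hρ.1] : (0 : ℝ) < ρ)
  · refine Measurable.aemeasurable ?_
    simp only [hcirc, smul_eq_mul]
    exact (by fun_prop : Measurable fun q : ℝ × ℝ => ENNReal.ofReal q.1).mul
      ((measurable_one.indicator hT).comp hmeas)

/-- Jensen's inequality for `log ‖b‖`. -/
theorem log_norm_le_circleAverage {b : ℂ → ℂ} {ζ : ℂ} {ρ : ℝ} (hρ : 0 < ρ)
    (hb : AnalyticOnNhd ℂ b (closedBall ζ ρ)) (h0 : b ζ ≠ 0) :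
    Real.log ‖b ζ‖ ≤ Real.circleAverage (fun z => Real.log ‖b z‖) ζ ρ := by
  have hb' : AnalyticOnNhd ℂ b (closedBall ζ |ρ|) := by rwa [abs_of_pos hρ]
  rw [AnalyticOnNhd.circleAverage_log_norm hρ.ne' hb' h0]
  refine le_add_of_nonneg_left (finsum_nonneg fun u => ?_)
  by_cases hu : u ∈ closedBall ζ |ρ|
  · refine mul_nonneg ?_ ?_
    · exact_mod_cast (MeromorphicOn.AnalyticOnNhd.divisor_nonneg hb') u
    · rcases eq_or_ne u ζ with rfl | hne
      · simp
      · refine Real.log_nonneg ?_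
        have : 0 < ‖ζ - u‖ := norm_pos_iff.2 (sub_ne_zero.2 hne.symm)
        rw [← div_eq_mul_inv, one_le_div this]
        simpa [abs_of_pos hρ, dist_eq_norm, norm_sub_rev] using hu
  · simp [Function.locallyFinsuppWithin.apply_eq_zero_of_notMem _ hu]

/-- A two-constants estimate: a holomorphic function bounded by `K`, and bounded by `1` off a set
of small area, is bounded by `K ^ ε` in the interior. -/
theorem log_norm_le_of_volume_lt {b : ℂ → ℂ} {U T : Set ℂ} {ζ : ℂ} {s ε K : ℝ} (hU : IsOpen U)
    (hb : DifferentiableOn ℂ b U) (hs : 0 < s) (hζ : closedBall ζ s ⊆ U) (hε : 0 ≤ ε)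
    (hK : 1 ≤ K) (hbK : ∀ z ∈ U, ‖b z‖ ≤ K) (hb1 : ∀ z ∈ U, z ∉ T → ‖b z‖ ≤ 1)
    (hT : MeasurableSet T) (hTv : volume T < ENNReal.ofReal (ε * s ^ 2 / 4)) :
    Real.log ‖b ζ‖ ≤ ε * Real.log K := by
  have hlogK : 0 ≤ Real.log K := Real.log_nonneg hK
  rcases eq_or_ne (b ζ) 0 with h0 | h0
  · simp only [h0, norm_zero, Real.log_zero]; positivity
  obtain ⟨ρ, hρ, hA⟩ := exists_radius_volume_angle_le (ζ := ζ) hT hs hTv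
  have hρ0 : 0 < ρ := by linarith [hρ.1]
  have hsub : closedBall ζ ρ ⊆ U := (closedBall_subset_closedBall hρ.2.le).trans hζ
  have han : AnalyticOnNhd ℂ b (closedBall ζ ρ) := (hb.analyticOnNhd hU).mono hsub
  refine (log_norm_le_circleAverage hρ0 han h0).trans ?_
  have hmem : ∀ θ, circleMap ζ ρ θ ∈ U := fun θ => hsub (circleMap_mem_closedBall ζ hρ0.le θ)
  set S : Set ℝ := {θ : ℝ | circleMap ζ ρ θ ∈ T} with hS
  have hSm : MeasurableSet S := (measurable_circleMap ζ ρ) hT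
  have hper : Function.Periodic (fun θ => Real.log ‖b (circleMap ζ ρ θ)‖) (2 * Real.pi) :=
    fun θ => by simp only [periodic_circleMap ζ ρ θ]
  have hci : CircleIntegrable (fun z => Real.log ‖b z‖) ζ ρ :=
    MeromorphicOn.circleIntegrable_log_norm fun z hz =>
      (han z (by rw [abs_of_pos hρ0] at hz; exact sphere_subset_closedBall hz)).meromorphicAt
  have hint : IntervalIntegrable (fun θ => Real.log ‖b (circleMap ζ ρ θ)‖) volume
      (-Real.pi) Real.pi :=
    hper.intervalIntegrable₀ Real.two_pi_pos.ne' hci _ _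
  have hpi := Real.pi_pos
  have hle : -Real.pi ≤ Real.pi := by linarith
  have hshift : ∫ θ in (0 : ℝ)..2 * Real.pi, Real.log ‖b (circleMap ζ ρ θ)‖
      = ∫ θ in (-Real.pi)..Real.pi, Real.log ‖b (circleMap ζ ρ θ)‖ := by
    have := hper.intervalIntegral_add_eq 0 (-Real.pi)
    rwa [zero_add, show -Real.pi + 2 * Real.pi = Real.pi by ring] at this
  have hbound : ∫ θ in (-Real.pi)..Real.pi, Real.log ‖b (circleMap ζ ρ θ)‖ ≤ ε * Real.log K := by
    rw [intervalIntegral.integral_of_le hle, integral_Ioc_eq_integral_Ioo]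
    have hfin : volume (S ∩ Ioo (-Real.pi) Real.pi) ≠ ⊤ := (hA.trans_lt ENNReal.ofReal_lt_top).ne
    calc ∫ θ in Ioo (-Real.pi) Real.pi, Real.log ‖b (circleMap ζ ρ θ)‖
        ≤ ∫ θ in Ioo (-Real.pi) Real.pi, S.indicator (fun _ => Real.log K) θ := by
          refine setIntegral_mono ?_ ?_ fun θ => ?_
          · exact ((intervalIntegrable_iff_integrableOn_Ioc_of_le hle).1 hint).mono_set
              Ioo_subset_Ioc_self
          · exact (integrableOn_const (by simp)).indicator hSm
          · by_cases hθ : θ ∈ S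
            · rw [indicator_of_mem hθ]
              rcases eq_or_ne (b (circleMap ζ ρ θ)) 0 with hz | hz
              · simpa [hz] using hlogK
              · exact Real.log_le_log (norm_pos_iff.2 hz) (hbK _ (hmem θ))
            · rw [indicator_of_notMem hθ]
              exact Real.log_nonpos (norm_nonneg _) (hb1 _ (hmem θ) hθ)
      _ = volume.real (S ∩ Ioo (-Real.pi) Real.pi) * Real.log K := by
          rw [integral_indicator hSm, Measure.restrict_restrict hSm, setIntegral_const,
            smul_eq_mul]
      _ ≤ ε * Real.log K := by
          gcongr
          exact ENNReal.toReal_le_of_le_ofReal hε hA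
  rw [Real.circleAverage, hshift, smul_eq_mul]
  have h2 : (2 * Real.pi)⁻¹ ≤ 1 := by
    refine inv_le_one_of_one_le₀ ?_
    linarith [Real.pi_gt_three]
  calc (2 * Real.pi)⁻¹ * _ ≤ (2 * Real.pi)⁻¹ * (ε * Real.log K) := by gcongr
    _ ≤ 1 * (ε * Real.log K) := by gcongr
    _ = _ := one_mul _

/-- A holomorphic germ whose Taylor coefficients satisfy Cauchy's estimates for the radius `ρ`
extends to every smaller disc, with a bound. -/
theorem exists_extension_of_norm_iteratedDeriv_le {F : Type*} [NormedAddCommGroup F]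
    [NormedSpace ℂ F] [CompleteSpace F] {ψ : ℂ → F} {q : ℂ} {η ρ ρ' R : ℝ} (hη : 0 < η)
    (hψ : DifferentiableOn ℂ ψ (ball q η)) (hρ' : 0 < ρ') (hρ : ρ' < ρ)
    (hR : ∀ l, ‖iteratedDeriv l ψ q‖ ≤ l.factorial * R / ρ ^ l) :
    ∃ Ψ : ℂ → F, DifferentiableOn ℂ Ψ (ball q ρ') ∧
      (∀ y ∈ ball q ρ', ‖Ψ y‖ ≤ R / (1 - ρ' / ρ)) ∧ Ψ =ᶠ[𝓝 q] ψ := by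
  have hρ0 : 0 < ρ := hρ'.trans hρ
  have hlt : ρ' / ρ < 1 := (div_lt_one hρ0).2 hρ
  have hR0 : 0 ≤ R := by simpa using (norm_nonneg _).trans (hR 0)
  set t : ℕ → ℂ → F := fun l y => (l.factorial : ℂ)⁻¹ • (y - q) ^ l • iteratedDeriv l ψ q
  have hsum : HasSum (fun l : ℕ => R * (ρ' / ρ) ^ l) (R / (1 - ρ' / ρ)) :=
    (hasSum_geometric_of_lt_one (by positivity) hlt).mul_left R
  have hb : ∀ l, ∀ y ∈ ball q ρ', ‖t l y‖ ≤ R * (ρ' / ρ) ^ l := fun l y hy => by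
    have hy' : ‖y - q‖ ≤ ρ' := by rw [mem_ball, dist_eq_norm] at hy; exact hy.le
    have hf : (0 : ℝ) < l.factorial := by positivity
    calc ‖t l y‖ = (l.factorial : ℝ)⁻¹ * (‖y - q‖ ^ l * ‖iteratedDeriv l ψ q‖) := by
          simp only [t, norm_smul, norm_inv, norm_pow, Complex.norm_natCast]
      _ ≤ (l.factorial : ℝ)⁻¹ * (ρ' ^ l * (l.factorial * R / ρ ^ l)) := by
          gcongr; exact hR l
      _ = R * (ρ' / ρ) ^ l := by rw [div_pow]; field_simp
  refine ⟨fun y => ∑' l, t l y, ?_, fun y hy => tsum_of_norm_bounded hsum fun l => hb l y hy, ?_⟩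
  · exact Complex.differentiableOn_tsum_of_summable_norm hsum.summable
      (fun l => by fun_prop) isOpen_ball hb
  · filter_upwards [isOpen_ball.mem_nhds (mem_ball_self hη)] with y hy
    exact (Complex.hasSum_taylorSeries_on_ball hψ hy).tsum_eq

namespace Projectivization

variable {m : ℕ}

/-- The normalized absolute value of the `i`-th homogeneous coordinate. -/
noncomputable def normCoord (i : Fin (m + 1)) (x : Projectivization ℂ (Fin (m + 1) → ℂ)) : ℝ :=
  ‖x.rep i‖ / ‖x.rep‖

/-- The `i`-th affine chart, normalized so that the `i`-th coordinate is `1`. -/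
noncomputable def chart (i : Fin (m + 1)) (x : Projectivization ℂ (Fin (m + 1) → ℂ)) :
    Fin (m + 1) → ℂ :=
  (x.rep i)⁻¹ • x.rep

theorem normCoord_mk (i : Fin (m + 1)) {v : Fin (m + 1) → ℂ} (hv : v ≠ 0) :
    normCoord i (mk ℂ v hv) = ‖v i‖ / ‖v‖ := by
  obtain ⟨a, ha⟩ := exists_smul_eq_mk_rep ℂ v hv
  have : ‖(a : ℂ)‖ ≠ 0 := by simp
  rw [normCoord, ← ha, Units.smul_def, norm_smul, Pi.smul_apply, norm_smul,
    mul_div_mul_left _ _ this]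

theorem chart_mk (i : Fin (m + 1)) {v : Fin (m + 1) → ℂ} (hv : v ≠ 0) :
    chart i (mk ℂ v hv) = (v i)⁻¹ • v := by
  obtain ⟨a, ha⟩ := exists_smul_eq_mk_rep ℂ v hv
  have : (a : ℂ) ≠ 0 := a.ne_zero
  rw [chart, ← ha, Units.smul_def, Pi.smul_apply, smul_smul, smul_eq_mul, mul_inv]
  congr 1
  field_simp

theorem norm_rep_pos (x : Projectivization ℂ (Fin (m + 1) → ℂ)) : 0 < ‖x.rep‖ :=
  norm_pos_iff.2 x.rep_nonzero

theorem rep_apply_ne_zero {i : Fin (m + 1)} {x : Projectivization ℂ (Fin (m + 1) → ℂ)}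
    (h : 0 < normCoord i x) : x.rep i ≠ 0 := by
  intro h0
  simp [normCoord, h0] at h

theorem norm_chart (i : Fin (m + 1)) (x : Projectivization ℂ (Fin (m + 1) → ℂ)) :
    ‖chart i x‖ = (normCoord i x)⁻¹ := by
  rw [chart, norm_smul, norm_inv, normCoord, inv_div, div_eq_inv_mul]

theorem norm_chart_le {i : Fin (m + 1)} {x : Projectivization ℂ (Fin (m + 1) → ℂ)} {δ : ℝ}
    (hδ : 0 < δ) (h : δ ≤ normCoord i x) : ‖chart i x‖ ≤ 1 / δ := by
  rw [norm_chart, one_div]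
  gcongr

theorem rep_eq_smul_chart {i : Fin (m + 1)} {x : Projectivization ℂ (Fin (m + 1) → ℂ)}
    (h : 0 < normCoord i x) : x.rep = x.rep i • chart i x := by
  rw [chart, smul_inv_smul₀ (rep_apply_ne_zero h)]

theorem chart_ne_zero {i : Fin (m + 1)} {x : Projectivization ℂ (Fin (m + 1) → ℂ)}
    (h : 0 < normCoord i x) : chart i x ≠ 0 :=
  smul_ne_zero (inv_ne_zero (rep_apply_ne_zero h)) x.rep_nonzero

theorem mk_chart {i : Fin (m + 1)} {x : Projectivization ℂ (Fin (m + 1) → ℂ)}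
    (h : 0 < normCoord i x) : mk ℂ (chart i x) (chart_ne_zero h) = x := by
  conv_rhs => rw [← mk_rep x]
  rw [mk_eq_mk_iff']
  exact ⟨(x.rep i)⁻¹, rfl⟩

theorem exists_normCoord_pos (x : Projectivization ℂ (Fin (m + 1) → ℂ)) :
    ∃ i, 0 < normCoord i x := by
  obtain ⟨i, hi⟩ := Function.ne_iff.1 x.rep_nonzero
  exact ⟨i, div_pos (norm_pos_iff.2 hi) x.norm_rep_pos⟩

/-- `v` is a representative of `x` normalized by `v i = 1`, in a form without division. -/
theorem mk_rep_eq_smul_iff {i : Fin (m + 1)} {v w : Fin (m + 1) → ℂ} (hv : v ≠ 0) :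
    (mk ℂ v hv).rep = (mk ℂ v hv).rep i • w ↔ v = v i • w := by
  obtain ⟨a, ha⟩ := exists_smul_eq_mk_rep ℂ v hv
  rw [← ha, Units.smul_def, Pi.smul_apply, smul_assoc]
  exact (smul_right_injective _ a.ne_zero).eq_iff

theorem le_normCoord_of_rep_eq_smul {i : Fin (m + 1)}
    {x : Projectivization ℂ (Fin (m + 1) → ℂ)} {w : Fin (m + 1) → ℂ} {C : ℝ}
    (h : x.rep = x.rep i • w) (hw : ‖w‖ ≤ C) : 1 / C ≤ normCoord i x := by
  have hx := x.norm_rep_pos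
  have h1 : ‖x.rep‖ = ‖x.rep i‖ * ‖w‖ := by
    conv_lhs => rw [h, norm_smul]
  have hw0 : 0 < ‖w‖ := by
    by_contra! h0
    rw [le_antisymm h0 (norm_nonneg _), mul_zero] at h1
    exact hx.ne' h1
  have hC : 0 < C := hw0.trans_le hw
  rw [normCoord, div_le_div_iff₀ hC hx, one_mul, h1]
  gcongr

end Projectivization

namespace IsHolomorphicOnP

open Projectivization

variable {m : ℕ} {E E' : Type} [NormedAddCommGroup E] [NormedSpace ℂ E]
  [NormedAddCommGroup E'] [NormedSpace ℂ E']

theorem comp {S : Set E} {S' : Set E'} {f : E → Projectivization ℂ (Fin (m + 1) → ℂ)}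
    {γ : E' → E} (hf : IsHolomorphicOnP S f) (hγ : Differentiable ℂ γ) (h : MapsTo γ S' S) :
    IsHolomorphicOnP S' (fun z => f (γ z)) := by
  intro z hz
  obtain ⟨U, hU, hzU, F, hF, hFd, hfF⟩ := hf (γ z) (h hz)
  exact ⟨γ ⁻¹' U, hU.preimage hγ.continuous, hzU, F ∘ γ, fun w hw => hF _ hw,
    hFd.comp hγ.differentiableOn fun w hw => hw, fun w hw hwS => hfF _ hw (h hwS)⟩

theorem mono {S S' : Set E} {f : E → Projectivization ℂ (Fin (m + 1) → ℂ)}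
    (hf : IsHolomorphicOnP S f) (h : S' ⊆ S) : IsHolomorphicOnP S' f :=
  hf.comp differentiable_id h

theorem continuousOn_normCoord {S : Set E} {f : E → Projectivization ℂ (Fin (m + 1) → ℂ)}
    (hf : IsHolomorphicOnP S f) (i : Fin (m + 1)) :
    ContinuousOn (fun z => normCoord i (f z)) S := by
  intro z hz
  obtain ⟨U, hU, hzU, F, hF, hFd, hfF⟩ := hf z hz
  have hc : ContinuousAt F z := (hFd.differentiableAt (hU.mem_nhds hzU)).continuousAt
  have hc' : ContinuousAt (fun w => ‖F w i‖ / ‖F w‖) z :=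
    ((continuousAt_pi.1 hc i).norm).div hc.norm (norm_ne_zero_iff.2 (hF z hzU))
  refine hc'.continuousWithinAt.congr_of_eventuallyEq ?_ ?_
  · filter_upwards [self_mem_nhdsWithin, mem_nhdsWithin_of_mem_nhds (hU.mem_nhds hzU)] with w hw hwU
    rw [hfF w hwU hw, normCoord_mk]
  · rw [hfF z hzU hz, normCoord_mk]

theorem differentiableOn_chart {S : Set E} {f : E → Projectivization ℂ (Fin (m + 1) → ℂ)}
    (hf : IsHolomorphicOnP S f) (hS : IsOpen S) {i : Fin (m + 1)}
    (hi : ∀ z ∈ S, 0 < normCoord i (f z)) :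
    DifferentiableOn ℂ (fun z => chart i (f z)) S := by
  intro z hz
  obtain ⟨U, hU, hzU, F, hF, hFd, hfF⟩ := hf z hz
  have hd : DifferentiableAt ℂ F z := hFd.differentiableAt (hU.mem_nhds hzU)
  have hne : F z i ≠ 0 := by
    have := hi z hz
    rw [hfF z hzU hz, normCoord_mk] at this
    intro h0
    simp [h0] at this
  have hd' : DifferentiableAt ℂ (fun w => (F w i)⁻¹ • F w) z :=
    ((differentiableAt_pi.1 hd i).inv hne).smul hd
  refine (hd'.congr_of_eventuallyEq ?_).differentiableWithinAt
  filter_upwards [hS.mem_nhds hz, hU.mem_nhds hzU] with w hw hwU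
  rw [hfF w hwU hw, chart_mk]

theorem of_chart {S : Set E} {f : E → Projectivization ℂ (Fin (m + 1) → ℂ)}
    (h : ∀ z ∈ S, ∃ i, ∃ U ∈ 𝓝 z, (∀ w ∈ U, 0 < normCoord i (f w)) ∧
      ∀ w ∈ U, DifferentiableAt ℂ (fun z => chart i (f z)) w) :
    IsHolomorphicOnP S f := by
  intro z hz
  obtain ⟨i, U, hU, hpos, hd⟩ := h z hz
  obtain ⟨V, hVU, hV, hzV⟩ := _root_.mem_nhds_iff.1 hU
  exact ⟨V, hV, hzV, fun w => chart i (f w), fun w hw => chart_ne_zero (hpos w (hVU hw)),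
    fun w hw => (hd w (hVU hw)).differentiableWithinAt,
    fun w hw _ => (mk_chart (hpos w (hVU hw))).symm⟩

/-- Identity principle: a holomorphic vector function that represents a holomorphic map into
projective space near one point represents it on the whole domain. -/
theorem rep_eq_smul_of_eventually {V : Set ℂ} {g : ℂ → Projectivization ℂ (Fin (m + 1) → ℂ)}
    {Ψ : ℂ → Fin (m + 1) → ℂ} {i : Fin (m + 1)} {q : ℂ} (hg : IsHolomorphicOnP V g)
    (hV : IsOpen V) (hVc : IsPreconnected V) (hΨ : DifferentiableOn ℂ Ψ V) (hq : q ∈ V)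
    (h : ∀ᶠ y in 𝓝 q, (g y).rep = (g y).rep i • Ψ y) :
    ∀ y ∈ V, (g y).rep = (g y).rep i • Ψ y := by
  set u : Set ℂ := {y | ∀ᶠ w in 𝓝 y, (g w).rep = (g w).rep i • Ψ w} with hu
  have huo : IsOpen u := isOpen_setOfPred_eventually_nhds
  have hsub : V ⊆ u := by
    refine hVc.subset_of_closure_inter_subset huo ⟨q, hq, h⟩ fun y ⟨hyu, hyV⟩ => ?_
    obtain ⟨U, hU, hyU, F, hF, hFd, hgF⟩ := hg y hyV
    obtain ⟨ε, hε, hB⟩ := Metric.isOpen_iff.1 (hU.inter hV) y ⟨hyU, hyV⟩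
    have hrel : ∀ w ∈ ball y ε, ((g w).rep = (g w).rep i • Ψ w ↔ F w - F w i • Ψ w = 0) :=
      fun w hw => by
        rw [hgF w (hB hw).1 (hB hw).2, mk_rep_eq_smul_iff, sub_eq_zero]
    obtain ⟨y', hy'B, hy'u⟩ := mem_closure_iff.1 hyu _ isOpen_ball (mem_ball_self hε)
    have hFB : DifferentiableOn ℂ F (ball y ε) := hFd.mono fun w hw => (hB hw).1
    have han : AnalyticOnNhd ℂ (fun w => F w - F w i • Ψ w) (ball y ε) :=
      DifferentiableOn.analyticOnNhd
        (hFB.sub ((differentiableOn_pi.1 hFB i).smul (hΨ.mono fun w hw => (hB hw).2)))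
        isOpen_ball
    have hz := han.eqOn_zero_of_preconnected_of_eventuallyEq_zero
      (convex_ball y ε).isPreconnected hy'B (by
        filter_upwards [hy'u, isOpen_ball.mem_nhds hy'B] with w hw hwB
        exact (hrel w hwB).1 hw)
    filter_upwards [isOpen_ball.mem_nhds (mem_ball_self hε)] with w hw
    exact (hrel w hw).2 (hz hw)
  exact fun y hy => (hsub hy).self_of_nhds

end IsHolomorphicOnP

open Projectivization in
/-- Propagation of a lower bound for `normCoord i (g x y)` from a small disc in `y` to a fixed
disc, when the bound holds on the large disc for all `x` outside a set of small area. -/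
theorem le_normCoord_of_volume_lt {m : ℕ} {g : ℂ → ℂ → Projectivization ℂ (Fin (m + 1) → ℂ)}
    {i : Fin (m + 1)} {x₀ y₀ q : ℂ} {r η δ ε : ℝ} {T : Set ℂ} (hη : 0 < η) (hηr : η < r / 8)
    (hq : q ∈ ball y₀ (r / 8)) (hδ : 0 < δ)
    (h₂ : ∀ x ∈ ball x₀ r, IsHolomorphicOnP (ball y₀ r) (g x))
    (h₁ : ∀ y ∈ ball y₀ r, IsHolomorphicOnP (ball x₀ r) (fun x => g x y))
    (hsmall : ∀ x ∈ ball x₀ r, ∀ y ∈ ball q η, δ ≤ normCoord i (g x y))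
    (hbig : ∀ x ∈ ball x₀ r, x ∉ T → ∀ y ∈ ball y₀ r, δ ≤ normCoord i (g x y))
    (hT : MeasurableSet T) (hTv : volume T < ENNReal.ofReal (ε * (r / 2) ^ 2 / 4))
    (hε0 : 0 ≤ ε) (hε : ε * Real.log (r / η) ≤ Real.log 2)
    {x y : ℂ} (hx : x ∈ ball x₀ (r / 4)) (hy : y ∈ ball y₀ (r / 16)) :
    δ / 4 ≤ normCoord i (g x y) := by
  have hr : 0 < r := by linarith
  have hqd : dist q y₀ < r / 8 := hq
  set R : ℝ := 1 / δ with hR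
  have hR0 : 0 < R := by positivity
  have hηsub : ball q η ⊆ ball y₀ r := ball_subset_ball' (by linarith)
  set G : ℂ → ℂ → Fin (m + 1) → ℂ := fun x y => chart i (g x y) with hG
  have hG₂ : ∀ x ∈ ball x₀ r, DifferentiableOn ℂ (G x) (ball q η) := fun x hx =>
    ((h₂ x hx).mono hηsub).differentiableOn_chart isOpen_ball
      fun y hy => hδ.trans_le (hsmall x hx y hy)
  have hG₁ : ∀ y ∈ ball q η, DifferentiableOn ℂ (fun x => G x y) (ball x₀ r) := fun y hy =>
    (h₁ y (hηsub hy)).differentiableOn_chart isOpen_ball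
      fun x hx => hδ.trans_le (hsmall x hx y hy)
  have hGR : ∀ x ∈ ball x₀ r, ∀ y ∈ ball q η, ‖G x y‖ ≤ R := fun x hx y hy =>
    norm_chart_le hδ (hsmall x hx y hy)
  have cauchy : ∀ x ∈ ball x₀ r, ∀ l, ∀ ρ' > 0, ∀ V : Set ℂ, IsOpen V → closedBall q ρ' ⊆ V →
      V ⊆ ball y₀ r → (∀ y ∈ V, δ ≤ normCoord i (g x y)) →
      ‖iteratedDeriv l (G x) q‖ ≤ l.factorial * R / ρ' ^ l := by
    intro x hx l ρ' hρ' V hV hsub hVr hb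
    have hd : DifferentiableOn ℂ (G x) V :=
      ((h₂ x hx).mono hVr).differentiableOn_chart hV fun y hy => hδ.trans_le (hb y hy)
    refine Complex.norm_iteratedDeriv_le_of_forall_mem_sphere_norm_le l hρ'
      (hd.mono ?_).diffContOnCl fun y hy =>
        norm_chart_le hδ (hb y (hsub (sphere_subset_closedBall hy)))
    rwa [closure_ball q hρ'.ne']
  have hxr : x ∈ ball x₀ r := ball_subset_ball (by linarith) hx
  have hxs : closedBall x (r / 2) ⊆ ball x₀ r := fun w hw => by
    rw [mem_closedBall] at hw
    rw [mem_ball] at hx ⊢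
    linarith [dist_triangle w x x₀]
  have hcoef : ∀ l, ‖iteratedDeriv l (G x) q‖ ≤ l.factorial * R / (r / 4) ^ l := by
    intro l
    rw [pi_norm_le_iff_of_nonneg (by positivity)]
    intro j
    set k : ℝ := (r / 2) ^ l / (l.factorial * R) with hk
    have hk0 : 0 < k := by positivity
    have hnorm : ∀ w, ∀ t : ℝ, 0 < t → ‖iteratedDeriv l (G w) q‖ ≤ l.factorial * R / t ^ l →
        ‖iteratedDeriv l (G w) q j * (k : ℂ)‖ ≤ (r / 2 / t) ^ l := fun w t ht hw => by
      rw [norm_mul, Complex.norm_of_nonneg hk0.le]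
      calc ‖iteratedDeriv l (G w) q j‖ * k ≤ l.factorial * R / t ^ l * k := by
            gcongr; exact (norm_le_pi_norm _ j).trans hw
        _ = (r / 2 / t) ^ l := by rw [hk, div_pow (r / 2)]; field_simp
    have hone : 1 ≤ r / η := by rw [one_le_div hη]; linarith
    have key := log_norm_le_of_volume_lt (b := fun w => iteratedDeriv l (G w) q j * (k : ℂ))
      (K := (r / η) ^ l) isOpen_ball
      ((differentiableOn_pi.1
        (differentiableOn_iteratedDeriv_snd isOpen_ball l hη hG₂ hG₁ hGR) j).mul_const _)
      (half_pos hr) hxs hε0 (one_le_pow₀ hone) (fun w hw => ?_) (fun w hw hwT => ?_) hT hTv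
    · have hle : ‖iteratedDeriv l (G x) q j * (k : ℂ)‖ ≤ 2 ^ l := by
        rcases (norm_nonneg (iteratedDeriv l (G x) q j * (k : ℂ))).eq_or_lt with h0 | h0
        · rw [← h0]; positivity
        · rw [← Real.log_le_log_iff h0 (by positivity)]
          refine key.trans ?_
          rw [Real.log_pow, Real.log_pow, mul_left_comm]
          gcongr
      rw [norm_mul, Complex.norm_of_nonneg hk0.le, ← le_div_iff₀ hk0] at hle
      refine hle.trans (le_of_eq ?_)
      rw [hk, show r / 2 = 2 * (r / 4) by ring, mul_pow]
      field_simp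
    · refine (hnorm w (η / 2) (by positivity)
        (cauchy w hw l (η / 2) (by positivity) _ isOpen_ball
          (closedBall_subset_ball (by linarith)) hηsub (hsmall w hw))).trans (le_of_eq ?_)
      congr 1; field_simp
    · refine (hnorm w (r / 2) (by positivity)
        (cauchy w hw l (r / 2) (by positivity) _ isOpen_ball (fun v hv => ?_)
          subset_rfl (hbig w hw hwT))).trans (le_of_eq ?_)
      · rw [mem_closedBall] at hv
        rw [mem_ball]
        linarith [dist_triangle v q y₀]
      · rw [div_self (by positivity), one_pow]
  obtain ⟨Ψ, hΨd, hΨb, hΨ⟩ := exists_extension_of_norm_iteratedDeriv_le (ρ' := 3 * r / 16) hη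
    (hG₂ x hxr) (by positivity) (by linarith) hcoef
  have hV : ball q (3 * r / 16) ⊆ ball y₀ r := ball_subset_ball' (by linarith)
  have hyq : y ∈ ball q (3 * r / 16) := by
    rw [mem_ball] at hy ⊢
    linarith [dist_triangle_right y q y₀]
  have hrel := ((h₂ x hxr).mono hV).rep_eq_smul_of_eventually (i := i) isOpen_ball
    (convex_ball q _).isPreconnected hΨd (mem_ball_self (by positivity)) (by
      filter_upwards [hΨ, isOpen_ball.mem_nhds (mem_ball_self hη)] with w hw hwη
      rw [hw]
      exact rep_eq_smul_chart (hδ.trans_le (hsmall x hxr w hwη))) y hyq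
  refine le_trans (le_of_eq ?_) (le_normCoord_of_rep_eq_smul hrel (hΨb y hyq))
  rw [hR]
  field_simp
  norm_num

/-- Baire: if countably many closed sets cover a ball, one of them contains a ball centred in it. -/
theorem exists_ball_subset_of_isClosed_cover {E : ℕ → Set ℂ} (hE : ∀ k, IsClosed (E k)) {c : ℂ}
    {ρ : ℝ} (hρ : 0 < ρ) (hcov : ball c ρ ⊆ ⋃ k, E k) {η₀ : ℝ} (hη₀ : 0 < η₀) :
    ∃ k, ∃ q ∈ ball c ρ, ∃ η > 0, η < η₀ ∧ ball q η ⊆ E k := by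
  have hdense := dense_iUnion_interior_of_closed (f := fun k => E k ∪ (ball c ρ)ᶜ)
    (fun k => (hE k).union isOpen_ball.isClosed_compl) (by
      rw [← iUnion_union, eq_univ_iff_forall]
      intro a
      by_cases ha : a ∈ ball c ρ
      · exact Or.inl (hcov ha)
      · exact Or.inr ha)
  obtain ⟨q, hq, hqi⟩ := hdense.inter_open_nonempty _ isOpen_ball ⟨c, mem_ball_self hρ⟩
  obtain ⟨k, hk⟩ := mem_iUnion.1 hqi
  obtain ⟨η, hη, hsub⟩ := Metric.isOpen_iff.1 (isOpen_interior.inter isOpen_ball) q ⟨hk, hq⟩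
  refine ⟨k, q, hq, min η (η₀ / 2), by positivity,
    (min_le_right _ _).trans_lt (half_lt_self hη₀), fun w hw => ?_⟩
  have hw' := hsub (ball_subset_ball (min_le_left _ _) hw)
  exact (interior_subset hw'.1).resolve_right fun h => h hw'.2

/-- If an increasing sequence of closed sets covers a ball, it nearly exhausts its area. -/
theorem exists_volume_diff_lt_of_isClosed_cover {E : ℕ → Set ℂ} (hE : ∀ k, IsClosed (E k))
    (hmono : Monotone E) {c : ℂ} {r : ℝ} (hcov : ball c r ⊆ ⋃ k, E k) {v : ENNReal}
    (hv : 0 < v) : ∃ k, volume (ball c r \ E k) < v := by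
  have hlim := tendsto_measure_iInter_atTop (μ := (volume : Measure ℂ))
    (s := fun k => ball c r \ E k)
    (fun k => (measurableSet_ball.diff (hE k).measurableSet).nullMeasurableSet)
    (fun k l hkl => sdiff_subset_sdiff_right (hmono hkl))
    ⟨0, ((measure_mono sdiff_subset).trans_lt measure_ball_lt_top).ne⟩
  rw [← sdiff_iUnion, sdiff_eq_empty.2 hcov, measure_empty] at hlim
  exact (hlim.eventually (gt_mem_nhds hv)).exists

section Slices

open Projectivization Function

variable {ι : Type} [Fintype ι] [DecidableEq ι] {m : ℕ} {Ω : Set (ι → ℂ)}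
  {f : (ι → ℂ) → Projectivization ℂ (Fin (m + 1) → ℂ)}

theorem isHolomorphicOnP_update_slice
    (hf : ∀ (k : ι) (c : ℂ), IsHolomorphicOnP (Ω ∩ {z | z k = c}) f) (k : ι) (a : ℂ) :
    IsHolomorphicOnP {z | update z k a ∈ Ω} (fun z => f (update z k a)) := by
  refine (hf k a).comp (γ := fun z => update z k a) ?_ fun z hz => ⟨hz, by simp⟩
  rw [differentiable_pi]
  intro j
  rcases eq_or_ne j k with rfl | hj
  · simp
  · simp only [update_of_ne hj]; fun_prop

theorem isHolomorphicOnP_update_line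
    (hf : ∀ (k : ι) (c : ℂ), IsHolomorphicOnP (Ω ∩ {z | z k = c}) f) {k k' : ι} (hk : k' ≠ k)
    (z : ι → ℂ) :
    IsHolomorphicOnP {a | update z k a ∈ Ω} (fun a => f (update z k a)) :=
  (hf k' (z k')).comp (fun a => (hasFDerivAt_update z a).differentiableAt)
    fun a ha => ⟨ha, by simp [hk]⟩

theorem update_mem_closedBall {p z : ι → ℂ} {r : ℝ} (hz : z ∈ closedBall p r) {k : ι} {a : ℂ}
    (ha : a ∈ closedBall (p k) r) : update z k a ∈ closedBall p r := by
  have hr : 0 ≤ r := dist_nonneg.trans hz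
  rw [mem_closedBall, dist_pi_le_iff hr] at hz ⊢
  intro j
  rcases eq_or_ne j k with rfl | hj
  · simpa using ha
  · simpa [hj] using hz j

theorem update_mem_ball {p z : ι → ℂ} {r : ℝ} (hz : z ∈ ball p r) {k : ι} {a : ℂ}
    (ha : a ∈ ball (p k) r) : update z k a ∈ ball p r := by
  have hr : 0 < r := pos_of_mem_ball hz
  rw [mem_ball, dist_pi_lt_iff hr] at hz ⊢
  intro j
  rcases eq_or_ne j k with rfl | hj
  · simpa using ha
  · simpa [hj] using hz j

/-- The values `a` of the coordinate `k` for which `normCoord i ∘ f` is at least `δ` on the part of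
the slice `z k = a` at distance less than `1 / (l + 1)` from the hyperplane `z k₀ = p k₀`. -/
def sliceSet (f : (ι → ℂ) → Projectivization ℂ (Fin (m + 1) → ℂ)) (i : Fin (m + 1)) (p : ι → ℂ)
    (r δ : ℝ) (k₀ k : ι) (l : ℕ) : Set ℂ :=
  {a ∈ closedBall (p k) r | ∀ z ∈ closedBall p r, dist (z k₀) (p k₀) < 1 / ((l : ℝ) + 1) →
    δ ≤ normCoord i (f (update z k a))}

variable {i : Fin (m + 1)} {p : ι → ℂ} {r δ : ℝ} {k₀ k : ι}

theorem monotone_sliceSet : Monotone (sliceSet f i p r δ k₀ k) := by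
  intro l l' hl a ha
  refine ⟨ha.1, fun z hz hd => ha.2 z hz (hd.trans_le ?_)⟩
  gcongr

theorem isClosed_sliceSet
    (hf : ∀ (k : ι) (c : ℂ), IsHolomorphicOnP (Ω ∩ {z | z k = c}) f) (hΩ : closedBall p r ⊆ Ω)
    (hk : k₀ ≠ k) (l : ℕ) : IsClosed (sliceSet f i p r δ k₀ k l) := by
  have e : sliceSet f i p r δ k₀ k l = closedBall (p k) r ∩
      ⋂ z ∈ {z ∈ closedBall p r | dist (z k₀) (p k₀) < 1 / ((l : ℝ) + 1)},
        closedBall (p k) r ∩ (fun a => normCoord i (f (update z k a))) ⁻¹' Ici δ := by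
    ext a
    simp only [sliceSet, mem_ofPred_eq, mem_inter_iff, mem_iInter, mem_preimage, mem_Ici]
    exact ⟨fun h => ⟨h.1, fun z hz => ⟨h.1, h.2 z hz.1 hz.2⟩⟩,
      fun h => ⟨h.1, fun z hz hd => (h.2 z ⟨hz, hd⟩).2⟩⟩
  rw [e]
  refine isClosed_closedBall.inter (isClosed_biInter fun z hz => ?_)
  refine ContinuousOn.preimage_isClosed_of_isClosed ?_ isClosed_closedBall isClosed_Ici
  exact ((isHolomorphicOnP_update_line hf hk z).mono
    fun a ha => hΩ (update_mem_closedBall hz.1 ha)).continuousOn_normCoord i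

theorem closedBall_subset_iUnion_sliceSet
    (hf : ∀ (k : ι) (c : ℂ), IsHolomorphicOnP (Ω ∩ {z | z k = c}) f) (hΩ : closedBall p r ⊆ Ω)
    (hk : k₀ ≠ k) (hδ : ∀ z ∈ closedBall p r, z k₀ = p k₀ → δ < normCoord i (f z)) :
    closedBall (p k) r ⊆ ⋃ l, sliceSet f i p r δ k₀ k l := by
  intro a ha
  have hcont : ContinuousOn (fun z => normCoord i (f (update z k a))) (closedBall p r) :=
    ((isHolomorphicOnP_update_slice hf k a).mono
      fun z hz => hΩ (update_mem_closedBall hz ha)).continuousOn_normCoord i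
  set B : Set (ι → ℂ) :=
    closedBall p r ∩ (fun z => normCoord i (f (update z k a))) ⁻¹' Iic δ with hB
  have hBc : IsCompact B := (isCompact_closedBall p r).of_isClosed_subset
    (hcont.preimage_isClosed_of_isClosed isClosed_closedBall isClosed_Iic) inter_subset_left
  obtain ⟨ε, hε, hBε⟩ : ∃ ε > 0, ∀ z ∈ B, ε ≤ dist (z k₀) (p k₀) := by
    rcases B.eq_empty_or_nonempty with h0 | h0
    · exact ⟨1, one_pos, by simp [h0]⟩
    · obtain ⟨w, hw, hmin⟩ := hBc.exists_isMinOn h0 (f := fun z : ι → ℂ => dist (z k₀) (p k₀))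
        (by fun_prop)
      refine ⟨_, dist_pos.2 fun heq => ?_, fun z hz => hmin hz⟩
      refine (hδ (update w k a) (update_mem_closedBall hw.1 ha) ?_).not_ge hw.2
      rw [update_of_ne hk, heq]
  obtain ⟨l, hl⟩ := exists_nat_one_div_lt hε
  refine mem_iUnion.2 ⟨l, ha, fun z hz hd => ?_⟩
  by_contra! hlt
  exact ((hBε z ⟨hz, hlt.le⟩).trans_lt (hd.trans hl)).false

/-- A lower bound for `normCoord i ∘ f` on a slice through `p` gives one near `p`. -/
theorem exists_ball_le_normCoord
    (hf : ∀ (k : ι) (c : ℂ), IsHolomorphicOnP (Ω ∩ {z | z k = c}) f) (hΩ : closedBall p r ⊆ Ω)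
    {k₁ k₂ : ι} (h₀₁ : k₀ ≠ k₁) (h₀₂ : k₀ ≠ k₂) (h₁₂ : k₁ ≠ k₂) (hr : 0 < r) (hδ0 : 0 < δ)
    (hδ : ∀ z ∈ closedBall p r, z k₀ = p k₀ → δ < normCoord i (f z)) :
    ∃ t > 0, t ≤ r ∧ ∀ z ∈ ball p t, δ / 4 ≤ normCoord i (f z) := by
  obtain ⟨l₂, q, hq, η, hη, hηr, hqη⟩ := exists_ball_subset_of_isClosed_cover
    (isClosed_sliceSet (i := i) (δ := δ) hf hΩ h₀₂) (c := p k₂) (ρ := r / 8) (by positivity)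
    ((ball_subset_closedBall.trans (closedBall_subset_closedBall (by linarith))).trans
      (closedBall_subset_iUnion_sliceSet hf hΩ h₀₂ hδ)) (η₀ := r / 8) (by positivity)
  have hlog : 0 < Real.log (r / η) := Real.log_pos (by rw [one_lt_div hη]; linarith)
  have hlog2 : 0 < Real.log 2 := Real.log_pos one_lt_two
  set ε : ℝ := Real.log 2 / Real.log (r / η) with hε
  have hε0 : 0 < ε := div_pos hlog2 hlog
  obtain ⟨l₁, hl₁⟩ := exists_volume_diff_lt_of_isClosed_cover
    (isClosed_sliceSet (i := i) (δ := δ) hf hΩ h₀₁) monotone_sliceSet (c := p k₁) (r := r)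
    (ball_subset_closedBall.trans (closedBall_subset_iUnion_sliceSet hf hΩ h₀₁ hδ))
    (v := ENNReal.ofReal (ε * (r / 2) ^ 2 / 4)) (ENNReal.ofReal_pos.2 (by positivity))
  set t : ℝ := min (r / 16) (min (1 / ((l₁ : ℝ) + 1)) (1 / ((l₂ : ℝ) + 1))) with ht
  have htr : t ≤ r / 16 := min_le_left _ _
  have ht₁ : t ≤ 1 / ((l₁ : ℝ) + 1) := (min_le_right _ _).trans (min_le_left _ _)
  have ht₂ : t ≤ 1 / ((l₂ : ℝ) + 1) := (min_le_right _ _).trans (min_le_right _ _)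
  refine ⟨t, by positivity, by linarith, fun z hz => ?_⟩
  have hzj : ∀ j, dist (z j) (p j) < t := (dist_pi_lt_iff (pos_of_mem_ball hz)).1 hz
  have hzr : z ∈ ball p r := ball_subset_ball (by linarith) hz
  have key := le_normCoord_of_volume_lt
    (g := fun x y => f (update (update z k₁ x) k₂ y)) (i := i) (x₀ := p k₁) (y₀ := p k₂)
    (T := ball (p k₁) r \ sliceSet f i p r δ k₀ k₁ l₁) hη hηr hq hδ0
    (fun x hx => (isHolomorphicOnP_update_line hf h₁₂ _).mono fun y hy =>
      hΩ (ball_subset_closedBall (update_mem_ball (update_mem_ball hzr hx) hy)))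
    (fun y hy => ?_) (fun x hx y hy => ?_) (fun x hx hxT y hy => ?_)
    (measurableSet_ball.diff (isClosed_sliceSet hf hΩ h₀₁ l₁).measurableSet) hl₁ hε0.le
    (by rw [hε, div_mul_cancel₀ _ hlog.ne'])
    (x := z k₁) (y := z k₂) ((hzj k₁).trans_le (by linarith)) ((hzj k₂).trans_le htr)
  · simpa using key
  · simp only [update_comm h₁₂]
    exact (isHolomorphicOnP_update_line hf h₁₂.symm _).mono fun x hx =>
      hΩ (ball_subset_closedBall (update_mem_ball (update_mem_ball hzr hy) hx))
  · exact (hqη hy).2 _ (ball_subset_closedBall (update_mem_ball hzr hx))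
      (by rw [update_of_ne h₀₁]; exact (hzj k₀).trans_le ht₂)
  · have hxE : x ∈ sliceSet f i p r δ k₀ k₁ l₁ := by
      by_contra h
      exact hxT ⟨hx, h⟩
    simp only [update_comm h₁₂]
    exact hxE.2 _ (ball_subset_closedBall (update_mem_ball hzr hy))
      (by rw [update_of_ne h₀₂]; exact (hzj k₀).trans_le ht₁)

/-- A map into projective space whose restrictions to all coordinate hyperplane slices are
holomorphic is holomorphic, in dimension at least three. -/
theorem isHolomorphicOnP_of_slices (hΩ : IsOpen Ω)
    (hf : ∀ (k : ι) (c : ℂ), IsHolomorphicOnP (Ω ∩ {z | z k = c}) f)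
    {k₀ k₁ k₂ : ι} (h₀₁ : k₀ ≠ k₁) (h₀₂ : k₀ ≠ k₂) (h₁₂ : k₁ ≠ k₂) : IsHolomorphicOnP Ω f := by
  refine IsHolomorphicOnP.of_chart fun p hp => ?_
  obtain ⟨i, hi⟩ := exists_normCoord_pos (f p)
  set δ : ℝ := normCoord i (f p) / 2 with hδ
  have hδ0 : 0 < δ := half_pos hi
  obtain ⟨r, hr, hrΩ, hrδ⟩ : ∃ r > 0, closedBall p r ⊆ Ω ∧
      ∀ z ∈ closedBall p r, z k₀ = p k₀ → δ < normCoord i (f z) := by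
    have hc := (hf k₀ (p k₀)).continuousOn_normCoord i p ⟨hp, rfl⟩
    have hev := hc.eventually (lt_mem_nhds (half_lt_self hi))
    rw [eventually_nhdsWithin_iff] at hev
    obtain ⟨r, hr, h⟩ := nhds_basis_closedBall.eventually_iff.1 (hev.and (hΩ.mem_nhds hp))
    exact ⟨r, hr, fun z hz => (h hz).2, fun z hz hzk => (h hz).1 ⟨(h hz).2, hzk⟩⟩
  obtain ⟨t, ht, htr, htδ⟩ := exists_ball_le_normCoord hf hrΩ h₀₁ h₀₂ h₁₂ hr hδ0 hrδ
  have hpos : ∀ z ∈ ball p t, 0 < normCoord i (f z) := fun z hz =>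
    (by positivity : 0 < δ / 4).trans_le (htδ z hz)
  have htΩ : ball p t ⊆ Ω := (ball_subset_ball htr).trans (ball_subset_closedBall.trans hrΩ)
  have hsub : ∀ w ∈ ball p (t / 2), ball w (t / 2) ⊆ ball p t := fun w hw =>
    ball_subset_ball' (by rw [mem_ball] at hw; linarith)
  refine ⟨i, ball p (t / 2), ball_mem_nhds p (half_pos ht),
    fun w hw => hpos w (ball_subset_ball (by linarith) hw), fun w hw => ?_⟩
  refine differentiableAt_of_update (i := k₀) (R := t / 2) (M := 1 / (δ / 4)) (half_pos ht)
    (fun z hz => norm_chart_le (by positivity) (htδ z (hsub w hw hz))) (fun a ha => ?_)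
    fun z hz => ?_
  · exact ((isHolomorphicOnP_update_slice hf k₀ a).mono fun z hz =>
      htΩ (hsub w hw (update_mem_ball hz ha))).differentiableOn_chart isOpen_ball
      fun z hz => hpos _ (hsub w hw (update_mem_ball hz ha))
  · exact ((isHolomorphicOnP_update_line hf h₀₁.symm z).mono fun a ha =>
      htΩ (hsub w hw (update_mem_ball hz ha))).differentiableOn_chart isOpen_ball
      fun a ha => hpos _ (hsub w hw (update_mem_ball hz ha))

end Slices

/-- **Lemma 1.** If `n ≥ 2`, `Ω` is an open domain in `ℂ^{n+1}`, and the restriction of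
`f : Ω → ℙ^m` to `Ω ∩ Πⁿ` is holomorphic for every coordinate `n`-plane `Πⁿ`, then `f`
is holomorphic on `Ω`. -/
theorem hartogs_lemma_codim_one (n m : ℕ) (hn : 2 ≤ n)
    (Ω : Set (Fin (n + 1) → ℂ)) (hΩopen : IsOpen Ω) (hΩconn : IsConnected Ω)
    (f : (Fin (n + 1) → ℂ) → Projectivization ℂ (Fin (m + 1) → ℂ))
    (hf : ∀ P : Set (Fin (n + 1) → ℂ), IsCoordPlane (n + 1) n P →
      IsHolomorphicOnP (Ω ∩ P) f) :
    IsHolomorphicOnP Ω f := by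
  have hslice : ∀ (k : Fin (n + 1)) (c : ℂ), IsHolomorphicOnP (Ω ∩ {z | z k = c}) f :=
    fun k c => hf _ ⟨{k}, fun _ => c, by simp, by simp⟩
  have h01 : (⟨0, by omega⟩ : Fin (n + 1)) ≠ ⟨1, by omega⟩ := by simp
  have h02 : (⟨0, by omega⟩ : Fin (n + 1)) ≠ ⟨2, by omega⟩ := by simp
  have h12 : (⟨1, by omega⟩ : Fin (n + 1)) ≠ ⟨2, by omega⟩ := by simp
  exact isHolomorphicOnP_of_slices hΩopen hslice h01 h02 h12
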